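/- Let σ be the scaled error function with scaling factor α > 0 and u a standard Gaussian random vector on ℝ^F. Then for all x_i, x_j ∈ ℝ^F, E[σ(uᵀx_i)·σ(uᵀx_j)] = (1/(2π))·arcsin( α²·(x_iᵀx_j) / √((α²·‖x_i‖² + 1/2)·(α²·‖x_j‖² + 1/2)) ) + 1/4. -/

import Mathlib

open MeasureTheory ProbabilityTheory Filter

noncomputable section

/-- Euclidean inner product on `ℝ^F`. -/
def dot {F : ℕ} (u x : Fin F → ℝ) : ℝ := ∑ k, u k * x k

/-- Standard Gaussian measure on `ℝ^F` (zero mean, identity covariance). -/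
def stdGauss (F : ℕ) : Measure (Fin F → ℝ) := Measure.pi fun _ => gaussianReal 0 1

/-- The scaled error function with scaling factor `α`:
`σ(p) = (1/√π)·∫₀^{αp} e^{−t²} dt + 1/2`. -/
def erfScaled (α : ℝ) (p : ℝ) : ℝ :=
  (1 / Real.sqrt Real.pi) * (∫ t in (0:ℝ)..(α * p), Real.exp (-(t^2))) + 1/2

instance stdGauss_prob (F : ℕ) : IsProbabilityMeasure (stdGauss F) := by
  unfold stdGauss; infer_instance

lemma erf_eq (α p : ℝ) : erfScaled α p = (gaussianReal 0 (1/2)).real (Set.Iio (α * p)) := by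
  have hv : ((1/2 : NNReal)) ≠ 0 := by positivity
  have hpdf : ∀ x, gaussianPDFReal 0 (1/2) x = (1 / Real.sqrt Real.pi) * Real.exp (-(x^2)) := by
    intro x
    rw [gaussianPDFReal_def]
    have h1 : 2 * Real.pi * ((1/2 : NNReal) : ℝ) = Real.pi := by push_cast; ring
    have h2 : 2 * ((1/2 : NNReal) : ℝ) = 1 := by push_cast; ring
    simp only [h1, h2]
    simp
  have hint := integrable_gaussianPDFReal 0 (1/2)
  rw [Measure.real, gaussianReal_apply_eq_integral _ hv, ENNReal.toReal_ofReal
    (integral_nonneg fun x => gaussianPDFReal_nonneg _ _ _), ← integral_Iic_eq_integral_Iio]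
  have h3 := intervalIntegral.integral_Iic_sub_Iic (a := 0) (b := α * p)
    hint.integrableOn hint.integrableOn
  have h4 : ∫ x in Set.Iic 0, gaussianPDFReal 0 (1/2) x = 1/2 := by
    have h5 := integral_comp_neg_Ioi 0 (gaussianPDFReal 0 (1/2))
    rw [neg_zero] at h5
    rw [← h5]
    simp_rw [hpdf, neg_sq]
    rw [integral_const_mul]
    have h6 := integral_gaussian_Ioi 1
    simp only [neg_mul, one_mul, div_one] at h6
    rw [h6]
    have : Real.sqrt Real.pi ≠ 0 := by positivity
    field_simp
  rw [h4] at h3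
  rw [sub_eq_iff_eq_add.1 h3]
  simp_rw [hpdf]
  rw [intervalIntegral.integral_const_mul]
  rfl

lemma quadrant (φ : ℝ) (h1 : -(Real.pi/2) ≤ φ) (h2 : φ ≤ Real.pi/2) :
    ((gaussianReal 0 1).prod (gaussianReal 0 1)).real
      {p : ℝ × ℝ | 0 < p.1 ∧ 0 < Real.sin φ * p.1 + Real.cos φ * p.2} =
      1/4 + φ / (2 * Real.pi) := by
  have hpi := Real.pi_pos
  set S := {p : ℝ × ℝ | 0 < p.1 ∧ 0 < Real.sin φ * p.1 + Real.cos φ * p.2} with hS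
  have hmeas : MeasurableSet S := by
    have a1 : MeasurableSet {p : ℝ × ℝ | 0 < p.1} :=
      measurableSet_lt measurable_const measurable_fst
    have a2 : MeasurableSet {p : ℝ × ℝ | 0 < Real.sin φ * p.1 + Real.cos φ * p.2} :=
      measurableSet_lt measurable_const (by fun_prop)
    exact a1.inter a2
  rw [gaussianReal_of_var_ne_zero 0 one_ne_zero,
    prod_withDensity (measurable_gaussianPDF _ _) (measurable_gaussianPDF _ _),
    ← integral_indicator_one hmeas, integral_withDensity_eq_integral_toReal_smul
      (by have := measurable_gaussianPDF 0 1; fun_prop)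
      (by filter_upwards with x; exact ENNReal.mul_lt_top gaussianPDF_lt_top gaussianPDF_lt_top),
    ← Measure.volume_eq_prod, ← integral_comp_polarCoord_symm, polarCoord_target]
  have key : ∀ p ∈ Set.Ioi (0:ℝ) ×ˢ Set.Ioo (-Real.pi) Real.pi,
      p.1 • (fun z : ℝ × ℝ => (gaussianPDF 0 1 z.1 * gaussianPDF 0 1 z.2).toReal •
        S.indicator (1 : ℝ × ℝ → ℝ) z) (polarCoord.symm p) =
      (p.1 * Real.exp (-(1/2) * p.1^2)) *
        ((Set.Ioo (-φ) (Real.pi/2)).indicator (fun _ => (2 * Real.pi)⁻¹) p.2) := by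
    rintro ⟨r, θ⟩ ⟨hr, hθ⟩
    simp only [Set.mem_Ioi, Set.mem_Ioo] at hr hθ
    have hmem : (r * Real.cos θ, r * Real.sin θ) ∈ S ↔ θ ∈ Set.Ioo (-φ) (Real.pi/2) := by
      have e : Real.sin φ * (r * Real.cos θ) + Real.cos φ * (r * Real.sin θ)
        = r * Real.sin (θ + φ) := by rw [Real.sin_add]; ring
      simp only [hS, Set.mem_ofPred_eq, e, mul_pos_iff_of_pos_left hr, Set.mem_Ioo]
      constructor
      · rintro ⟨hc, hs⟩
        have hlt : |θ| < Real.pi/2 := by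
          by_contra! hge
          have := Real.cos_nonpos_of_pi_div_two_le_of_le hge
            (by have := (abs_lt.2 hθ); linarith)
          rw [Real.cos_abs] at this
          linarith
        rw [abs_lt] at hlt
        refine ⟨?_, hlt.2⟩
        by_contra! hle
        have := Real.sin_nonpos_of_nonpos_of_neg_pi_le (x := θ + φ) (by linarith) (by linarith)
        linarith
      · rintro ⟨ha, hb⟩
        exact ⟨Real.cos_pos_of_mem_Ioo ⟨by linarith, hb⟩,
          Real.sin_pos_of_pos_of_lt_pi (by linarith) (by linarith)⟩
    simp only [polarCoord_symm_apply]
    by_cases hm : θ ∈ Set.Ioo (-φ) (Real.pi/2)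
    · rw [Set.indicator_of_mem (hmem.2 hm), Set.indicator_of_mem hm]
      simp only [ENNReal.toReal_mul, toReal_gaussianPDF, gaussianPDFReal_def, smul_eq_mul,
        Pi.one_apply, NNReal.coe_one, mul_one, sub_zero]
      have e1 : ∀ s a b : ℝ, (s⁻¹ * Real.exp a) * (s⁻¹ * Real.exp b) =
        (s*s)⁻¹ * Real.exp (a+b) := by
        intro s a b; rw [Real.exp_add, mul_inv]; ring
      rw [e1, Real.mul_self_sqrt (by positivity)]
      have e2 : -(r * Real.cos θ)^2/2 + -(r * Real.sin θ)^2/2 = -(1/2) * r^2 := by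
        have := Real.sin_sq_add_cos_sq θ
        linear_combination (-(1/2) * r^2) * this
      rw [e2]; ring
    · rw [Set.indicator_of_notMem (fun h => hm (hmem.1 h)), Set.indicator_of_notMem hm]
      simp
  rw [setIntegral_congr_fun (measurableSet_Ioi.prod measurableSet_Ioo) key,
    Measure.volume_eq_prod, setIntegral_prod_mul (fun r : ℝ => r * Real.exp (-(1/2) * r^2))
      ((Set.Ioo (-φ) (Real.pi/2)).indicator (fun _ => (2 * Real.pi)⁻¹)),
    setIntegral_indicator measurableSet_Ioo,
    Set.inter_eq_right.2 (Set.Ioo_subset_Ioo (by linarith) (by linarith))]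
  have hr : ∫ r in Set.Ioi (0:ℝ), r * Real.exp (-(1/2) * r^2) = 1 := by
    have := integral_rpow_mul_exp_neg_mul_rpow (p := 2) (q := 1) (b := 1/2)
      (by norm_num) (by norm_num) (by norm_num)
    norm_num at this
    norm_num
    rw [this]
  rw [hr, setIntegral_const, Measure.real, Real.volume_Ioo,
    ENNReal.toReal_ofReal (by linarith), smul_eq_mul]
  field_simp
  ring

lemma cf_gauss (v : NNReal) (t : ℝ) :
    ∫ z, Complex.exp (((t * z : ℝ) : ℂ) * Complex.I) ∂(gaussianReal 0 v)
      = Complex.exp ((-(v * t^2 / 2) : ℝ)) := by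
  have := charFun_gaussianReal (μ := 0) (v := v) t
  rw [charFun_apply_real] at this
  push_cast
  rw [this]
  congr 1
  push_cast
  ring

lemma cf_std (F : ℕ) (w : Fin F → ℝ) :
    ∫ u, Complex.exp (((dot u w : ℝ) : ℂ) * Complex.I) ∂(stdGauss F)
      = Complex.exp ((-(dot w w / 2) : ℝ)) := by
  unfold dot stdGauss
  have : ∀ u : Fin F → ℝ, Complex.exp (((∑ k, u k * w k : ℝ) : ℂ) * Complex.I) =
      ∏ k, (fun k (z : ℝ) => Complex.exp (((w k * z : ℝ) : ℂ) * Complex.I)) k (u k) := by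
    intro u
    rw [← Complex.exp_sum]
    congr 1
    push_cast
    rw [Finset.sum_mul]
    exact Finset.sum_congr rfl fun k _ => by ring
  rw [integral_congr_ae (Filter.Eventually.of_forall this),
    integral_fintype_prod_eq_prod (E := fun _ : Fin F => ℝ)
      (fun k (z : ℝ) => Complex.exp (((w k * z : ℝ) : ℂ) * Complex.I))]
  simp_rw [cf_gauss]
  rw [← Complex.exp_sum]
  congr 1
  push_cast
  rw [Finset.sum_div, ← Finset.sum_neg_distrib]
  exact Finset.sum_congr rfl fun k _ => by push_cast; ring

lemma dot_comb {F : ℕ} (u x y : Fin F → ℝ) (a b : ℝ) :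
    dot u (fun k => a * x k + b * y k) = a * dot u x + b * dot u y := by
  unfold dot
  rw [Finset.mul_sum, Finset.mul_sum, ← Finset.sum_add_distrib]
  exact Finset.sum_congr rfl fun k _ => by ring

lemma dot_comm' {F : ℕ} (u x : Fin F → ℝ) : dot u x = dot x u := by
  unfold dot
  exact Finset.sum_congr rfl fun k _ => by ring

@[fun_prop]
lemma dot_meas {F : ℕ} (x : Fin F → ℝ) : Measurable (fun u : Fin F → ℝ => dot u x) := by
  unfold dot; fun_prop

lemma law (F : ℕ) (α : ℝ) (xi xj : Fin F → ℝ) (s1 s2 φ : ℝ) (hs1 : 0 < s1) (hs2 : 0 < s2)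
    (h1 : s1^2 = α^2 * dot xi xi + 1/2) (h2 : s2^2 = α^2 * dot xj xj + 1/2)
    (h3 : Real.sin φ * (s1 * s2) = α^2 * dot xi xj) :
    ((stdGauss F).prod ((gaussianReal 0 (1/2)).prod (gaussianReal 0 (1/2)))).map
      (fun q => ((α * dot q.1 xi - q.2.1) / s1, (α * dot q.1 xj - q.2.2) / s2)) =
    ((gaussianReal 0 1).prod (gaussianReal 0 1)).map
      (fun p => (p.1, Real.sin φ * p.1 + Real.cos φ * p.2)) := by
  have m1 : Measurable (fun q : (Fin F → ℝ) × (ℝ × ℝ) =>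
    ((α * dot q.1 xi - q.2.1) / s1, (α * dot q.1 xj - q.2.2) / s2)) := by
      have a1 : Measurable (fun q : (Fin F → ℝ) × (ℝ × ℝ) => dot q.1 xi) :=
        (dot_meas xi).comp measurable_fst
      have a2 : Measurable (fun q : (Fin F → ℝ) × (ℝ × ℝ) => dot q.1 xj) :=
        (dot_meas xj).comp measurable_fst
      fun_prop
  have m2 : Measurable (fun p : ℝ × ℝ => (p.1, Real.sin φ * p.1 + Real.cos φ * p.2)) := by
    fun_prop
  have := Measure.isProbabilityMeasure_map
    (μ := (stdGauss F).prod ((gaussianReal 0 (1/2)).prod (gaussianReal 0 (1/2)))) m1.aemeasurable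
  have := Measure.isProbabilityMeasure_map
    (μ := (gaussianReal 0 1).prod (gaussianReal 0 1)) m2.aemeasurable
  apply Measure.ext_of_charFunDual
  ext L
  obtain ⟨c, hc⟩ : ∃ c, c = L (1, 0) := ⟨_, rfl⟩
  obtain ⟨d, hd⟩ : ∃ d, d = L (0, 1) := ⟨_, rfl⟩
  have hL : ∀ x y, L (x, y) = c * x + d * y := by
    intro x y
    have : ((x, y) : ℝ × ℝ) = x • (1, 0) + y • (0, 1) := by simp
    rw [this, map_add, map_smul, map_smul, hc, hd, smul_eq_mul, smul_eq_mul]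
    ring
  rw [charFunDual_apply, charFunDual_apply, integral_map m1.aemeasurable
    (by apply Measurable.aestronglyMeasurable; fun_prop), integral_map m2.aemeasurable
    (by apply Measurable.aestronglyMeasurable; fun_prop)]
  simp_rw [hL]
  have e1 : ∀ q : (Fin F → ℝ) × (ℝ × ℝ),
      Complex.exp (((c * ((α * dot q.1 xi - q.2.1) / s1) + d * ((α * dot q.1 xj - q.2.2) / s2) : ℝ) : ℂ)
        * Complex.I) =
      Complex.exp ((dot q.1 (fun k => (c * α / s1) * xi k + (d * α / s2) * xj k) : ℝ) * Complex.I) *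
      (fun z : ℝ × ℝ => Complex.exp (((-c/s1) * z.1 : ℝ) * Complex.I) *
        Complex.exp (((-d/s2) * z.2 : ℝ) * Complex.I)) q.2 := by
    intro q
    simp only []
    rw [← Complex.exp_add, ← Complex.exp_add, dot_comb]
    congr 1
    push_cast
    ring
  have e2 : ∀ p : ℝ × ℝ, Complex.exp (((c * p.1 + d * (Real.sin φ * p.1 + Real.cos φ * p.2) : ℝ) : ℂ)
        * Complex.I) =
      Complex.exp (((c + d * Real.sin φ) * p.1 : ℝ) * Complex.I) *
        Complex.exp (((d * Real.cos φ) * p.2 : ℝ) * Complex.I) := by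
    intro p
    rw [← Complex.exp_add]
    congr 1
    push_cast
    ring
  simp_rw [e1, e2]
  rw [integral_prod_mul (fun u => Complex.exp ((dot u (fun k => (c * α / s1) * xi k + (d * α / s2) * xj k) : ℝ) * Complex.I))
    (fun z : ℝ × ℝ => Complex.exp (((-c/s1) * z.1 : ℝ) * Complex.I) *
        Complex.exp (((-d/s2) * z.2 : ℝ) * Complex.I)),
    integral_prod_mul (fun z : ℝ => Complex.exp (((-c/s1) * z : ℝ) * Complex.I))
      (fun z : ℝ => Complex.exp (((-d/s2) * z : ℝ) * Complex.I)),
    integral_prod_mul (fun z : ℝ => Complex.exp (((c + d * Real.sin φ) * z : ℝ) * Complex.I))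
      (fun z : ℝ => Complex.exp (((d * Real.cos φ) * z : ℝ) * Complex.I)),
    cf_std, cf_gauss, cf_gauss, cf_gauss, cf_gauss, ← Complex.exp_add, ← Complex.exp_add,
    ← Complex.exp_add, ← Complex.ofReal_add, ← Complex.ofReal_add, ← Complex.ofReal_add]
  congr 2
  rw [dot_comb, dot_comm' _ xi, dot_comm' _ xj, dot_comb, dot_comb, dot_comm' xj xi]
  have hA : α^2 * dot xi xi = s1^2 - 1/2 := by linarith
  have hC : α^2 * dot xj xj = s2^2 - 1/2 := by linarith
  have hsc := Real.sin_sq_add_cos_sq φ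
  linear_combination (norm := (push_cast; field_simp; ring)) (c^2/(2*s1^2)) * h1 +
    (d^2/(2*s2^2)) * h2 + (c*d/(s1*s2)) * h3 + (d^2/2) * hsc

theorem stmt1 (F : ℕ) (α : ℝ) (hα : 0 < α) (xi xj : Fin F → ℝ) :
    ∫ u, erfScaled α (dot u xi) * erfScaled α (dot u xj) ∂ stdGauss F
      = (1 / (2 * Real.pi)) *
          Real.arcsin (α^2 * dot xi xj /
            Real.sqrt ((α^2 * dot xi xi + 1/2) * (α^2 * dot xj xj + 1/2))) + 1/4 := by
  have nn : ∀ x : Fin F → ℝ, 0 ≤ dot x x := fun x =>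
    Finset.sum_nonneg fun k _ => mul_self_nonneg _
  have hA := nn xi
  have hC := nn xj
  have hCS : (dot xi xj)^2 ≤ dot xi xi * dot xj xj := by
    have := Finset.sum_mul_sq_le_sq_mul_sq Finset.univ xi xj
    simpa only [dot, sq] using this
  set s1 := Real.sqrt (α^2 * dot xi xi + 1/2) with hs1
  set s2 := Real.sqrt (α^2 * dot xj xj + 1/2) with hs2
  have p1 : 0 < s1 := Real.sqrt_pos.2 (by positivity)
  have p2 : 0 < s2 := Real.sqrt_pos.2 (by positivity)
  have q1 : s1^2 = α^2 * dot xi xi + 1/2 := Real.sq_sqrt (by positivity)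
  have q2 : s2^2 = α^2 * dot xj xj + 1/2 := Real.sq_sqrt (by positivity)
  rw [Real.sqrt_mul (by positivity), ← hs1, ← hs2]
  set ρ := α^2 * dot xi xj / (s1 * s2) with hρ
  have hρ1 : |ρ| ≤ 1 := by
    rw [hρ, abs_div, abs_of_pos (mul_pos p1 p2), div_le_one (mul_pos p1 p2)]
    apply abs_le_of_sq_le_sq _ (by positivity)
    rw [mul_pow, mul_pow, q1, q2]
    have : (α^2)^2 * dot xi xj ^2 ≤ (α^2)^2 * (dot xi xi * dot xj xj) := by gcongr
    have : 0 ≤ α^2 * dot xi xi := by positivity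
    have : 0 ≤ α^2 * dot xj xj := by positivity
    nlinarith
  rw [abs_le] at hρ1
  have hsin : Real.sin (Real.arcsin ρ) = ρ := Real.sin_arcsin hρ1.1 hρ1.2
  have hlaw := law F α xi xj s1 s2 (Real.arcsin ρ) p1 p2 q1 q2 (by
    rw [hsin, hρ]; field_simp)
  have hquad := quadrant (Real.arcsin ρ) (Real.neg_pi_div_two_le_arcsin _)
    (Real.arcsin_le_pi_div_two _)
  have m1 : Measurable (fun q : (Fin F → ℝ) × (ℝ × ℝ) =>
    ((α * dot q.1 xi - q.2.1) / s1, (α * dot q.1 xj - q.2.2) / s2)) := by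
      have a1 : Measurable (fun q : (Fin F → ℝ) × (ℝ × ℝ) => dot q.1 xi) :=
        (dot_meas xi).comp measurable_fst
      have a2 : Measurable (fun q : (Fin F → ℝ) × (ℝ × ℝ) => dot q.1 xj) :=
        (dot_meas xj).comp measurable_fst
      fun_prop
  have m2 : Measurable (fun p : ℝ × ℝ => (p.1, Real.sin (Real.arcsin ρ) * p.1 +
      Real.cos (Real.arcsin ρ) * p.2)) := by
    fun_prop
  have hQ : MeasurableSet (Set.Ioi (0:ℝ) ×ˢ Set.Ioi (0:ℝ)) :=
    measurableSet_Ioi.prod measurableSet_Ioi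
  have h5 := congrArg (fun m => m.real (Set.Ioi (0:ℝ) ×ˢ Set.Ioi (0:ℝ))) hlaw
  beta_reduce at h5
  rw [map_measureReal_apply m1 hQ, map_measureReal_apply m2 hQ] at h5
  have h6 : (fun p : ℝ × ℝ => (p.1, Real.sin (Real.arcsin ρ) * p.1 +
      Real.cos (Real.arcsin ρ) * p.2)) ⁻¹' (Set.Ioi (0:ℝ) ×ˢ Set.Ioi (0:ℝ)) =
      {p : ℝ × ℝ | 0 < p.1 ∧ 0 < Real.sin (Real.arcsin ρ) * p.1 +
        Real.cos (Real.arcsin ρ) * p.2} := rfl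
  rw [h6, hquad] at h5
  have h7 : 1 / (2 * Real.pi) * Real.arcsin ρ + 1/4 = 1/4 + Real.arcsin ρ / (2 * Real.pi) := by
    ring
  rw [h7, ← h5, Measure.real, Measure.prod_apply (m1 hQ), ← integral_toReal
    (measurable_measure_prodMk_left (m1 hQ)).aemeasurable
    (by filter_upwards with x; exact measure_lt_top _ _)]
  congr 1
  ext u
  rw [erf_eq, erf_eq, ← measureReal_prod_prod, Measure.real]
  congr 2
  ext z
  simp only [Set.mem_prod, Set.mem_Iio, Set.mem_preimage, Set.mem_Ioi]
  rw [div_pos_iff_of_pos_right p1, div_pos_iff_of_pos_right p2, sub_pos, sub_pos]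

end
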